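/- arXiv:1403.7325 — 5 statements merged into one kernel-verified Lean document; each statement's English description precedes it below -/
import Mathlib

section
/- There exist a₀ > 0 and a function a ↦ x(a) defined for a ∈ (0, a₀), with x(a) ≥ 1/a for every a and x(a) increasing as a decreases to 0, such that θ_a·x(a) − g(x(a)) − ln(a·θ_a) → 0 as a → 0. -/
open MeasureTheory ProbabilityTheory Filter Asymptotics Set Topology

/-- A boundary curve solving `θ a * x = g x + log (a * θ a)` exists and is antitone, as soon as `θ`
is comparable to the identity near `0` and increases at least linearly. -/
theorem exists_antitone_boundary {g θ : ℝ → ℝ} (hg : Continuous g)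
    (hgo : Tendsto (fun x => g x / x) atTop (𝓝 0))
    (hglog : Tendsto (fun x => g x - 2 * Real.log x) atTop atTop)
    {c M L a₁ : ℝ} (hc : 0 < c) (hL : 0 < L) (ha₁ : 0 < a₁)
    (hθl : ∀ a ∈ Ioo 0 a₁, c * a ≤ θ a) (hθu : ∀ a ∈ Ioo 0 a₁, θ a ≤ M * a)
    (hθs : ∀ a ∈ Ioo 0 a₁, ∀ b ∈ Ioo 0 a₁, a ≤ b → b - a ≤ L * (θ b - θ a)) :
    ∃ a₀ > (0 : ℝ), ∃ x : ℝ → ℝ,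
      (∀ a ∈ Ioo (0 : ℝ) a₀, 1 / a ≤ x a) ∧
      (∀ a ∈ Ioo (0 : ℝ) a₀, ∀ b ∈ Ioo (0 : ℝ) a₀, a ≤ b → x b ≤ x a) ∧
      Tendsto (fun a => θ a * x a - g (x a) - Real.log (a * θ a)) (𝓝[>] 0) (𝓝 0) := by
  set R : ℝ := 1 + L + 1 / c with hR
  have hcR : 0 < 1 / c := by positivity
  have hRpos : 0 < R := by positivity
  have hθpos : ∀ a ∈ Ioo 0 a₁, 0 < θ a := fun a ha =>
    (mul_pos hc ha.1).trans_le (hθl a ha)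
  obtain ⟨N, hN⟩ := eventually_atTop.1
    (hglog.eventually_ge_atTop (M * R - Real.log c - 2 * Real.log R))
  set N' := max N 1
  have hN' : 0 < N' := lt_of_lt_of_le one_pos (le_max_right _ _)
  set a₀ := min a₁ (R / N') with ha₀
  have ha₀pos : 0 < a₀ := lt_min ha₁ (by positivity)
  have hsub : ∀ a ∈ Ioo 0 a₀, a ∈ Ioo 0 a₁ := fun a ha =>
    ⟨ha.1, ha.2.trans_le (min_le_left _ _)⟩
  set h : ℝ → ℝ → ℝ := fun a x => θ a * x - g x - Real.log (a * θ a) with hh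
  have hcont : ∀ a, Continuous (h a) := fun a => by fun_prop
  set S : ℝ → Set ℝ := fun a => {x | h a x ≤ 0} with hS
  have hmem : ∀ a ∈ Ioo 0 a₀, R / a ∈ S a := by
    intro a ha
    have ha1 := hsub a ha
    have hapos := ha.1
    have hle : N ≤ R / a := by
      have h1 : a ≤ R / N' := (ha.2.trans_le (min_le_right _ _)).le
      have h2 : N' ≤ R / a := by
        rw [le_div_iff₀ hapos]; rw [le_div_iff₀ hN'] at h1; linarith
      exact (le_max_left _ _).trans h2
    have h3 := hN _ hle
    have h4 : θ a * (R / a) ≤ M * R := by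
      rw [← mul_div_assoc, div_le_iff₀ hapos]
      nlinarith [hθu a ha1]
    have h5 : Real.log c + 2 * Real.log a ≤ Real.log (a * θ a) := by
      have : Real.log c + 2 * Real.log a = Real.log (a * (c * a)) := by
        rw [Real.log_mul hapos.ne' (by positivity), Real.log_mul hc.ne' hapos.ne']; ring
      rw [this]
      exact Real.log_le_log (by positivity) (mul_le_mul_of_nonneg_left (hθl a ha1) hapos.le)
    rw [Real.log_div hRpos.ne' hapos.ne'] at h3
    change θ a * (R / a) - g (R / a) - Real.log (a * θ a) ≤ 0
    linarith
  have hbdd : ∀ a ∈ Ioo 0 a₀, BddAbove (S a) := by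
    intro a ha
    have hθa := hθpos a (hsub a ha)
    have e1 : ∀ᶠ x in atTop, g x / x < θ a / 2 :=
      hgo.eventually_lt_const (by positivity)
    obtain ⟨B, hB⟩ := eventually_atTop.1 (e1.and ((eventually_gt_atTop 0).and
      (eventually_gt_atTop (2 * Real.log (a * θ a) / θ a))))
    refine ⟨B, fun x hx => ?_⟩
    by_contra! hlt
    obtain ⟨h1, h2, h3⟩ := hB x hlt.le
    rw [div_lt_iff₀ h2] at h1
    rw [div_lt_iff₀ hθa] at h3
    have hx' : θ a * x - g x - Real.log (a * θ a) ≤ 0 := hx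
    linarith
  have hclosed : ∀ a, IsClosed (S a) := fun a => isClosed_le (hcont a) continuous_const
  have hge : ∀ a ∈ Ioo 0 a₀, R / a ≤ sSup (S a) := fun a ha => le_csSup (hbdd a ha) (hmem a ha)
  have hzero : ∀ a ∈ Ioo 0 a₀, h a (sSup (S a)) = 0 := by
    intro a ha
    refine le_antisymm ((hclosed a).csSup_mem ⟨_, hmem a ha⟩ (hbdd a ha)) ?_
    have ht : Tendsto (h a) (𝓝[>] (sSup (S a))) (𝓝 (h a (sSup (S a)))) :=
      (hcont a).continuousAt.tendsto.mono_left nhdsWithin_le_nhds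
    refine ge_of_tendsto ht ?_
    filter_upwards [self_mem_nhdsWithin] with x hx
    by_contra! hlt
    exact absurd (le_csSup (hbdd a ha) (show x ∈ S a from hlt.le)) (not_le.2 hx)
  refine ⟨a₀, ha₀pos, fun a => sSup (S a), fun a ha => ?_, fun a ha b hb hab => ?_, ?_⟩
  · refine le_trans ?_ (hge a ha)
    exact div_le_div_of_nonneg_right (by rw [hR]; linarith) ha.1.le
  · refine csSup_le ⟨_, hmem b hb⟩ fun x hx => ?_
    by_contra! hlt
    have hxa : x ∉ S a := fun hxS => absurd (le_csSup (hbdd a ha) hxS) (not_le.2 hlt)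
    have h1 : 0 < θ a * x - g x - Real.log (a * θ a) := not_le.1 hxa
    have h2 : θ b * x - g x - Real.log (b * θ b) ≤ 0 := hx
    have hxR : R < a * x := by
      have := (hge a ha).trans_lt hlt
      rwa [div_lt_iff₀ ha.1, mul_comm] at this
    have hθa := hθpos a (hsub a ha)
    have hθb := hθpos b (hsub b hb)
    have hapos := ha.1
    have hbpos := hb.1
    have hs := hθs a (hsub a ha) b (hsub b hb) hab
    have hd : 0 ≤ θ b - θ a := by
      by_contra! hneg
      nlinarith
    have l1 : Real.log b - Real.log a ≤ (b - a) / a := by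
      rw [← Real.log_div hbpos.ne' hapos.ne']
      refine (Real.log_le_sub_one_of_pos (by positivity)).trans (le_of_eq ?_)
      field_simp
    have l2 : Real.log (θ b) - Real.log (θ a) ≤ (θ b - θ a) / (c * a) := by
      rw [← Real.log_div hθb.ne' hθa.ne']
      have : (θ b - θ a) / θ a ≤ (θ b - θ a) / (c * a) :=
        div_le_div_of_nonneg_left hd (by positivity) (hθl a (hsub a ha))
      refine (Real.log_le_sub_one_of_pos (by positivity)).trans (le_trans (le_of_eq ?_) this)
      field_simp
    rw [Real.log_mul hapos.ne' hθa.ne'] at h1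
    rw [Real.log_mul hbpos.ne' hθb.ne'] at h2
    have h3 : (θ b - θ a) * x < (b - a) / a + (θ b - θ a) / (c * a) := by linarith
    have h4 : (b - a) / a + (θ b - θ a) / (c * a) = ((b - a) + (θ b - θ a) * (1 / c)) / a := by
      field_simp
    rw [h4, lt_div_iff₀ hapos] at h3
    have h5 : (θ b - θ a) * R ≤ (θ b - θ a) * (a * x) := mul_le_mul_of_nonneg_left hxR.le hd
    rw [hR] at h5
    linarith
  · refine tendsto_const_nhds.congr' ?_
    filter_upwards [Ioo_mem_nhdsGT ha₀pos] with a ha using (hzero a ha).symm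

theorem truncation_subset {Ω : Type*} {X : Ω → ℝ} {a b : ℝ} (ha : 0 < a) (hab : a ≤ b) (hb : b ≤ 1) :
    {ω | X ω - b ≤ 1 / b} ⊆ {ω | X ω - a ≤ 1 / a} := by
  intro ω hω
  have h1 : X ω - b ≤ 1 / b := hω
  change X ω - a ≤ 1 / a
  have hb0 : 0 < b := ha.trans_le hab
  have h2 : b + 1 / b ≤ a + 1 / a := by
    have : a + 1 / a - (b + 1 / b) = (b - a) * (1 - a * b) / (a * b) := by
      field_simp
      ring
    have h3 : 0 ≤ (b - a) * (1 - a * b) / (a * b) :=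
      div_nonneg (mul_nonneg (by linarith) (by nlinarith)) (by positivity)
    linarith
  linarith

section ExpMoment

variable {Ω : Type*} [MeasurableSpace Ω] {μ : Measure Ω} {X : Ω → ℝ}

theorem integrable_add_mul_add_mul_sq {f : Ω → ℝ} (hf : Integrable f μ) (hX1 : Integrable X μ)
    (hX2 : Integrable (fun ω => X ω ^ 2) μ) (p q : ℝ) :
    Integrable (fun ω => f ω + p * X ω + q * X ω ^ 2) μ :=
  (hf.add (hX1.const_mul p)).add (hX2.const_mul q)

theorem integral_add_mul_add_mul_sq {f : Ω → ℝ} (hf : Integrable f μ) (hX1 : Integrable X μ)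
    (hX2 : Integrable (fun ω => X ω ^ 2) μ) (hmean : ∫ ω, X ω ∂μ = 0) (p q : ℝ) :
    ∫ ω, (f ω + p * X ω + q * X ω ^ 2) ∂μ = ∫ ω, f ω ∂μ + q * ∫ ω, X ω ^ 2 ∂μ := by
  have h1 : Integrable (fun ω => f ω + p * X ω) μ := hf.add (hX1.const_mul p)
  rw [integral_add h1 (hX2.const_mul q), integral_add hf (hX1.const_mul p),
    integral_const_mul, integral_const_mul, hmean, mul_zero, add_zero]

theorem setIntegral_exp_eq_integral_indicator (hX : Measurable X) (s a t : ℝ) :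
    ∫ ω in {ω | X ω - a ≤ t}, Real.exp (s * (X ω - a)) ∂μ =
      ∫ ω, {ω | X ω - a ≤ t}.indicator (fun ω => Real.exp (s * (X ω - a))) ω ∂μ :=
  (integral_indicator (measurableSet_le (by fun_prop) (by fun_prop))).symm

variable [IsProbabilityMeasure μ]

theorem integrable_indicator_exp_mul (hX : Measurable X) {s : ℝ} (hs : 0 ≤ s) (a t : ℝ) :
    Integrable ({ω | X ω - a ≤ t}.indicator fun ω => Real.exp (s * (X ω - a))) μ := by
  have hm : MeasurableSet {ω | X ω - a ≤ t} := measurableSet_le (by fun_prop) (by fun_prop)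
  refine Integrable.of_bound
    ((Measurable.indicator (by fun_prop) hm).aestronglyMeasurable) (Real.exp (s * t)) ?_
  refine Eventually.of_forall fun ω => ?_
  by_cases h : ω ∈ {ω | X ω - a ≤ t}
  · rw [indicator_of_mem h, Real.norm_eq_abs, Real.abs_exp]
    exact Real.exp_le_exp.2 (mul_le_mul_of_nonneg_left h hs)
  · rw [indicator_of_notMem h, norm_zero]
    positivity

/-- Upper quadratic bound for the solution `s` of the truncated exponential moment equation. -/
theorem quadratic_le_of_truncated_exp_moment_eq_one (hX : Measurable X) (hX1 : Integrable X μ)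
    (hX2 : Integrable (fun ω => X ω ^ 2) μ) (hmean : ∫ ω, X ω ∂μ = 0)
    {a s : ℝ} (ha : 0 < a) (ha2 : a ≤ 1 / 2) (hs : 0 < s)
    (heq : ∫ ω in {ω | X ω - a ≤ 1 / a}, Real.exp (s * (X ω - a)) ∂μ = 1) :
    s ^ 2 / 8 * μ.real {ω | 1 < X ω} ≤
      s * a + (∫ ω, X ω ^ 2 ∂μ) * (a ^ 2 + s * a + s ^ 2 * a ^ 2 / 8) := by
  have hB : MeasurableSet {ω | 1 < X ω} := measurableSet_lt (by fun_prop) (by fun_prop)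
  rw [setIntegral_exp_eq_integral_indicator hX] at heq
  have hBi : Integrable ({ω | 1 < X ω}.indicator fun _ => (1 : ℝ)) μ :=
    (integrable_const (1 : ℝ)).indicator hB
  have key : ∀ ω, (1 - s * a) + s ^ 2 / 8 * {ω | 1 < X ω}.indicator (fun _ => (1 : ℝ)) ω + s * X ω
      + -(a ^ 2 + s * a + s ^ 2 * a ^ 2 / 8) * X ω ^ 2 ≤
      {ω | X ω - a ≤ 1 / a}.indicator (fun ω => Real.exp (s * (X ω - a))) ω := by
    intro ω
    by_cases hA : ω ∈ {ω | X ω - a ≤ 1 / a}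
    · rw [indicator_of_mem hA]
      have h0 : 0 ≤ (a ^ 2 + s * a + s ^ 2 * a ^ 2 / 8) * X ω ^ 2 := by positivity
      by_cases hb : ω ∈ {ω | 1 < X ω}
      · rw [indicator_of_mem hb]
        have hb' : 1 < X ω := hb
        have h1 : 1 / 2 ≤ X ω - a := by linarith
        have h2 := Real.quadratic_le_exp_of_nonneg (x := s * (X ω - a)) (by nlinarith)
        have h3 : s ^ 2 / 4 ≤ (s * (X ω - a)) ^ 2 := by
          rw [mul_pow]
          have : (1 : ℝ) / 4 ≤ (X ω - a) ^ 2 := by nlinarith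
          nlinarith [sq_nonneg s]
        nlinarith
      · rw [indicator_of_notMem hb]
        have := Real.add_one_le_exp (s * (X ω - a))
        linarith
    · rw [indicator_of_notMem hA]
      have hA' : 1 / a < X ω - a := not_le.1 hA
      have hx : 1 < a * X ω := by
        have : 1 / a < X ω := by linarith
        rwa [div_lt_iff₀ ha, mul_comm] at this
      have hx0 : 0 < X ω := by
        by_contra! hneg
        nlinarith
      have hi : {ω | 1 < X ω}.indicator (fun _ => (1 : ℝ)) ω ≤ 1 :=
        indicator_le_self' (fun _ _ => zero_le_one) ω
      have hsq : 1 ≤ a ^ 2 * X ω ^ 2 := by nlinarith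
      have h1 : s * X ω ≤ s * a * X ω ^ 2 := by
        have := mul_le_mul_of_nonneg_left hx.le (mul_pos hs hx0).le
        nlinarith
      have h2 : s ^ 2 / 8 * {ω | 1 < X ω}.indicator (fun _ => (1 : ℝ)) ω ≤
          s ^ 2 / 8 * (a ^ 2 * X ω ^ 2) :=
        mul_le_mul_of_nonneg_left (hi.trans hsq) (by positivity)
      nlinarith [mul_pos hs ha]
  have hf : Integrable (fun ω => (1 - s * a) +
      s ^ 2 / 8 * {ω | 1 < X ω}.indicator (fun _ => (1 : ℝ)) ω) μ :=
    (integrable_const _).add (hBi.const_mul _)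
  have hcmp := integral_mono (integrable_add_mul_add_mul_sq hf hX1 hX2 s _)
    (integrable_indicator_exp_mul hX hs.le a (1 / a)) key
  rw [heq, integral_add_mul_add_mul_sq hf hX1 hX2 hmean,
    integral_add (integrable_const _) (hBi.const_mul _), integral_const_mul,
    integral_indicator_const _ hB] at hcmp
  simp only [integral_const, probReal_univ, smul_eq_mul, one_mul, mul_one] at hcmp
  linarith

theorem exp_le_one_add_add_mul_sq {u M : ℝ} (hM : 0 ≤ M) (hu : u ≤ M) :
    Real.exp u ≤ 1 + u + Real.exp M * u ^ 2 := by
  have hM1 : 1 ≤ Real.exp M := Real.one_le_exp hM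
  have h1 : Real.exp u - 1 ≤ u * Real.exp u := by
    have := Real.add_one_le_exp (-u)
    have h2 : Real.exp u * Real.exp (-u) = 1 := by rw [← Real.exp_add]; simp
    nlinarith [Real.exp_pos u]
  rcases le_total 0 u with h0 | h0
  · have h3 := Real.exp_le_exp.2 hu
    nlinarith [mul_le_mul_of_nonneg_left h3 (sq_nonneg u), mul_le_mul_of_nonneg_left h1 h0]
  · have h3 := Real.add_one_le_exp u
    nlinarith [mul_le_mul_of_nonneg_left hM1 (sq_nonneg u)]

theorem mul_exp_mul_le {x s K : ℝ} (hs : 0 ≤ s) (hK : 1 ≤ K) (hx : Real.exp (s * x) ≤ K) :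
    x * Real.exp (s * x) ≤ x + K * s * x ^ 2 := by
  rcases le_total 0 x with h0 | h0
  · have := Real.add_one_le_exp (-(s * x))
    have h2 : Real.exp (s * x) * Real.exp (-(s * x)) = 1 := by rw [← Real.exp_add]; simp
    have h3 : Real.exp (s * x) - 1 ≤ s * x * Real.exp (s * x) := by
      nlinarith [Real.exp_pos (s * x)]
    have h4 : s * x * Real.exp (s * x) ≤ s * x * K :=
      mul_le_mul_of_nonneg_left hx (by positivity)
    nlinarith [mul_le_mul_of_nonneg_left (h3.trans h4) h0]
  · have h3 := Real.add_one_le_exp (s * x)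
    have h4 : s * x ^ 2 ≤ K * (s * x ^ 2) := le_mul_of_one_le_left (by positivity) hK
    nlinarith

/-- Lower linear bound for the solution `s` of the truncated exponential moment equation. -/
theorem le_mul_of_truncated_exp_moment_eq_one (hX : Measurable X) (hX1 : Integrable X μ)
    (hX2 : Integrable (fun ω => X ω ^ 2) μ) (hmean : ∫ ω, X ω ∂μ = 0)
    {a s M : ℝ} (ha : 0 < a) (hM : 0 ≤ M) (hs : 0 < s) (hsM : s ≤ M * a)
    (heq : ∫ ω in {ω | X ω - a ≤ 1 / a}, Real.exp (s * (X ω - a)) ∂μ = 1) :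
    a ≤ Real.exp M * s * (∫ ω, X ω ^ 2 ∂μ + a ^ 2) := by
  rw [setIntegral_exp_eq_integral_indicator hX] at heq
  set K := Real.exp M * s ^ 2 with hK
  have key : ∀ ω, {ω | X ω - a ≤ 1 / a}.indicator (fun ω => Real.exp (s * (X ω - a))) ω ≤
      (1 - s * a + K * a ^ 2) + (s - 2 * a * K) * X ω + K * X ω ^ 2 := by
    intro ω
    have hrw : (1 - s * a + K * a ^ 2) + (s - 2 * a * K) * X ω + K * X ω ^ 2 =
        1 + s * (X ω - a) + Real.exp M * (s * (X ω - a)) ^ 2 := by rw [hK]; ring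
    rw [hrw]
    by_cases hA : ω ∈ {ω | X ω - a ≤ 1 / a}
    · rw [indicator_of_mem hA]
      refine exp_le_one_add_add_mul_sq hM ?_
      have hA' : X ω - a ≤ 1 / a := hA
      calc s * (X ω - a) ≤ s * (1 / a) := mul_le_mul_of_nonneg_left hA' hs.le
        _ ≤ M := by rw [mul_one_div, div_le_iff₀ ha]; exact hsM
    · rw [indicator_of_notMem hA]
      have hA' : 1 / a < X ω - a := not_le.1 hA
      have : 0 < X ω - a := lt_trans (by positivity) hA'
      positivity
  have hf := integrable_const (μ := μ) (1 - s * a + K * a ^ 2)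
  have hcmp := integral_mono (integrable_indicator_exp_mul hX hs.le a (1 / a))
    (integrable_add_mul_add_mul_sq hf hX1 hX2 _ _) key
  rw [heq, integral_add_mul_add_mul_sq hf hX1 hX2 hmean] at hcmp
  simp only [integral_const, probReal_univ, smul_eq_mul, one_mul] at hcmp
  have h1 : s * a ≤ s * (Real.exp M * s * (∫ ω, X ω ^ 2 ∂μ + a ^ 2)) := by
    rw [hK] at hcmp; linarith
  exact le_of_mul_le_mul_left h1 hs

/-- The solution of the truncated exponential moment equation is monotone in the drift. -/
theorem truncated_exp_moment_solution_mono (hX : Measurable X)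
    {a b s t : ℝ} (ha : 0 < a) (hab : a < b) (hb : b ≤ 1) (hs : 0 < s) (ht : 0 < t)
    (heqa : ∫ ω in {ω | X ω - a ≤ 1 / a}, Real.exp (s * (X ω - a)) ∂μ = 1)
    (heqb : ∫ ω in {ω | X ω - b ≤ 1 / b}, Real.exp (t * (X ω - b)) ∂μ = 1) :
    s ≤ t := by
  rw [setIntegral_exp_eq_integral_indicator hX] at heqa heqb
  by_contra! hlt
  have hl0 : 0 < t / s := by positivity
  have hl1 : t / s ≤ 1 := by rw [div_le_one hs]; exact hlt.le
  have key : ∀ ω, Real.exp (t * (b - a)) *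
      {ω | X ω - b ≤ 1 / b}.indicator (fun ω => Real.exp (t * (X ω - b))) ω ≤
      (1 - t / s) + t / s *
        {ω | X ω - a ≤ 1 / a}.indicator (fun ω => Real.exp (s * (X ω - a))) ω := by
    intro ω
    by_cases hB : ω ∈ {ω | X ω - b ≤ 1 / b}
    · rw [indicator_of_mem hB, indicator_of_mem (truncation_subset ha hab.le hb hB),
        ← Real.exp_add]
      have hconv := convexOn_exp.2 (mem_univ 0) (mem_univ (s * (X ω - a)))
        (sub_nonneg.2 hl1) hl0.le (by ring)
      simp only [smul_eq_mul, mul_zero, zero_add, Real.exp_zero, mul_one] at hconv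
      refine le_of_eq_of_le ?_ hconv
      congr 1
      field_simp
      ring
    · rw [indicator_of_notMem hB, mul_zero]
      exact add_nonneg (sub_nonneg.2 hl1)
        (mul_nonneg hl0.le (indicator_nonneg (fun _ _ => (Real.exp_pos _).le) ω))
  have i1 := (integrable_indicator_exp_mul (μ := μ) hX hs.le a (1 / a)).const_mul (t / s)
  have hcmp := integral_mono
    ((integrable_indicator_exp_mul (μ := μ) hX ht.le b (1 / b)).const_mul _)
    ((integrable_const (1 - t / s)).add i1) key
  simp only [Pi.add_apply] at hcmp
  rw [integral_add (integrable_const _) i1, integral_const_mul, integral_const_mul,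
    heqa, heqb] at hcmp
  simp at hcmp
  nlinarith [mul_pos ht (sub_pos.2 hab)]

/-- The solution of the truncated exponential moment equation increases at least linearly. -/
theorem sub_le_mul_truncated_exp_moment_solution (hX : Measurable X) (hX1 : Integrable X μ)
    (hX2 : Integrable (fun ω => X ω ^ 2) μ) (hmean : ∫ ω, X ω ∂μ = 0)
    {a b s t M : ℝ} (ha : 0 < a) (hab : a < b) (hb : b ≤ 1) (hM : 0 ≤ M)
    (hs : 0 < s) (ht : 0 < t) (htM : t ≤ M * b)
    (heqa : ∫ ω in {ω | X ω - a ≤ 1 / a}, Real.exp (s * (X ω - a)) ∂μ = 1)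
    (heqb : ∫ ω in {ω | X ω - b ≤ 1 / b}, Real.exp (t * (X ω - b)) ∂μ = 1) :
    b - a ≤ Real.exp (2 * M) * (∫ ω, X ω ^ 2 ∂μ) * (t - s) := by
  have hst := truncated_exp_moment_solution_mono hX ha hab hb hs ht heqa heqb
  rw [setIntegral_exp_eq_integral_indicator hX] at heqa heqb
  have hb0 : 0 < b := ha.trans hab
  set K := Real.exp (2 * M) with hK
  have hK1 : 1 ≤ K := Real.one_le_exp (by positivity)
  have key : ∀ ω, Real.exp (t * b) *
      {ω | X ω - b ≤ 1 / b}.indicator (fun ω => Real.exp (t * (X ω - b))) ω ≤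
      Real.exp (s * a) *
        {ω | X ω - a ≤ 1 / a}.indicator (fun ω => Real.exp (s * (X ω - a))) ω +
      (t - s) * X ω + (t - s) * (K * t) * X ω ^ 2 := by
    intro ω
    by_cases hB : ω ∈ {ω | X ω - b ≤ 1 / b}
    · rw [indicator_of_mem hB, indicator_of_mem (truncation_subset ha hab.le hb hB),
        ← Real.exp_add, ← Real.exp_add]
      have e1 : t * b + t * (X ω - b) = t * X ω := by ring
      have e2 : s * a + s * (X ω - a) = s * X ω := by ring
      rw [e1, e2]
      have hB' : X ω - b ≤ 1 / b := hB
      have hxK : Real.exp (t * X ω) ≤ K := by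
        refine Real.exp_le_exp.2 ?_
        calc t * X ω ≤ t * (b + 1 / b) := mul_le_mul_of_nonneg_left (by linarith) ht.le
          _ ≤ M * b * (b + 1 / b) := mul_le_mul_of_nonneg_right htM (by positivity)
          _ = M * (b ^ 2 + 1) := by field_simp
          _ ≤ 2 * M := by nlinarith [mul_le_mul_of_nonneg_left hb hb0.le]
      have h1 := mul_exp_mul_le ht.le hK1 hxK
      have h2 : Real.exp (t * X ω) - Real.exp (s * X ω) ≤
          (t - s) * (X ω * Real.exp (t * X ω)) := by
        have h3 := Real.add_one_le_exp (s * X ω - t * X ω)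
        have h4 : Real.exp (t * X ω) * Real.exp (s * X ω - t * X ω) = Real.exp (s * X ω) := by
          rw [← Real.exp_add]; congr 1; ring
        nlinarith [mul_le_mul_of_nonneg_left h3 (Real.exp_pos (t * X ω)).le]
      nlinarith [mul_le_mul_of_nonneg_left h1 (sub_nonneg.2 hst)]
    · rw [indicator_of_notMem hB, mul_zero]
      have hB' : 1 / b < X ω - b := not_le.1 hB
      have hx : 0 ≤ X ω := by
        have : 0 < 1 / b := by positivity
        linarith
      have h0 : 0 ≤ t - s := sub_nonneg.2 hst
      have hi : 0 ≤ {ω | X ω - a ≤ 1 / a}.indicator (fun ω => Real.exp (s * (X ω - a))) ω :=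
        indicator_nonneg (fun _ _ => (Real.exp_pos _).le) ω
      positivity
  have i1 := (integrable_indicator_exp_mul (μ := μ) hX hs.le a (1 / a)).const_mul
    (Real.exp (s * a))
  have hcmp := integral_mono
    ((integrable_indicator_exp_mul (μ := μ) hX ht.le b (1 / b)).const_mul _)
    (integrable_add_mul_add_mul_sq i1 hX1 hX2 _ _) key
  rw [integral_add_mul_add_mul_sq i1 hX1 hX2 hmean, integral_const_mul, integral_const_mul,
    heqa, heqb] at hcmp
  simp only [mul_one] at hcmp
  have hsa : s * a ≤ t * a := mul_le_mul_of_nonneg_right hst ha.le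
  have h1 : t * b - s * a ≤ Real.exp (t * b) - Real.exp (s * a) := by
    have h3 := Real.add_one_le_exp (t * b - s * a)
    have h4 : Real.exp (s * a) * Real.exp (t * b - s * a) = Real.exp (t * b) := by
      rw [← Real.exp_add]; congr 1; ring
    have h5 : 1 ≤ Real.exp (s * a) := Real.one_le_exp (by positivity)
    nlinarith [mul_le_mul_of_nonneg_left h3 (Real.exp_pos (s * a)).le,
      mul_pos ht (sub_pos.2 hab)]
  have h2 : t * (b - a) ≤ t * (K * (∫ ω, X ω ^ 2 ∂μ) * (t - s)) := by nlinarith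
  exact le_of_mul_le_mul_left h2 ht

/-- The solution of the truncated exponential moment equation is of linear order and increases at
least linearly in the drift. -/
theorem exists_linear_bounds_of_truncated_exp_moment (hX : Measurable X)
    (hX2 : Integrable (fun ω => X ω ^ 2) μ) (hvar : 0 < ∫ ω, X ω ^ 2 ∂μ)
    (hmean : ∫ ω, X ω ∂μ = 0) (hp : 0 < μ.real {ω | 1 < X ω}) {θ : ℝ → ℝ}
    (hθpos : ∀ᶠ a in 𝓝[>] (0 : ℝ), 0 < θ a)
    (hθeq : ∀ᶠ a in 𝓝[>] (0 : ℝ),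
      ∫ ω in {ω | X ω - a ≤ 1 / a}, Real.exp (θ a * (X ω - a)) ∂μ = 1) :
    ∃ c > 0, ∃ M, ∃ L > 0, ∃ a₁ > 0,
      (∀ a ∈ Ioo 0 a₁, c * a ≤ θ a) ∧ (∀ a ∈ Ioo 0 a₁, θ a ≤ M * a) ∧
      (∀ a ∈ Ioo 0 a₁, ∀ b ∈ Ioo 0 a₁, a ≤ b → b - a ≤ L * (θ b - θ a)) := by
  have hX1 : Integrable X μ :=
    ((memLp_two_iff_integrable_sq hX.aestronglyMeasurable).2 hX2).integrable one_le_two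
  set V := ∫ ω, X ω ^ 2 ∂μ with hV
  set p := μ.real {ω | 1 < X ω} with hpdef
  set M := 1 + 16 * (2 * V + 1) / p with hMdef
  have hM0 : 0 < M := by positivity
  obtain ⟨δ, hδ, hδsub⟩ := mem_nhdsGT_iff_exists_Ioo_subset.1 (hθpos.and hθeq)
  have hδ' : 0 < δ := hδ
  set a₁ := min δ (min (1 / 2) (p / (2 * V))) with ha₁
  have hprop : ∀ a ∈ Ioo 0 a₁, a ≤ 1 / 2 ∧ V * a ^ 2 ≤ p / 2 ∧ 0 < θ a ∧
      ∫ ω in {ω | X ω - a ≤ 1 / a}, Real.exp (θ a * (X ω - a)) ∂μ = 1 := by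
    intro a ha
    have h1 : a < δ := ha.2.trans_le (min_le_left _ _)
    have h2 : a ≤ 1 / 2 := (ha.2.trans_le ((min_le_right _ _).trans (min_le_left _ _))).le
    have h3 : a ≤ p / (2 * V) :=
      (ha.2.trans_le ((min_le_right _ _).trans (min_le_right _ _))).le
    rw [le_div_iff₀ (by positivity)] at h3
    refine ⟨h2, ?_, hδsub ⟨ha.1, h1⟩⟩
    have : a ^ 2 ≤ a := by nlinarith [ha.1]
    nlinarith
  have hupper : ∀ a ∈ Ioo 0 a₁, θ a ≤ M * a := by
    intro a ha
    obtain ⟨h2, h3, hpos, heq⟩ := hprop a ha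
    have hq := quadratic_le_of_truncated_exp_moment_eq_one hX hX1 hX2 hmean ha.1 h2 hpos heq
    rw [← hV, ← hpdef] at hq
    by_contra! hlt
    have hapos := ha.1
    have hM' : M * p = p + 16 * (2 * V + 1) := by rw [hMdef]; field_simp
    have haθ : a ≤ θ a := by
      have h1 : 0 ≤ 16 * (2 * V + 1) / p := by positivity
      have hM1 : 1 ≤ M := by rw [hMdef]; linarith
      nlinarith
    have h5 : θ a ^ 2 * p / 16 ≤ V * a ^ 2 + θ a * a * (V + 1) := by
      nlinarith [mul_le_mul_of_nonneg_left h3 (sq_nonneg (θ a))]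
    have h6 : V * a ^ 2 ≤ V * (θ a * a) := by
      have : a ^ 2 ≤ θ a * a := by nlinarith
      nlinarith
    have h7 : θ a * (θ a * p) ≤ θ a * (a * (16 * (2 * V + 1))) := by nlinarith
    have h8 := le_of_mul_le_mul_left h7 hpos
    have h9 : M * a * p < θ a * p := mul_lt_mul_of_pos_right hlt hp
    nlinarith [mul_pos hapos hp]
  refine ⟨1 / (Real.exp M * (V + 1)), by positivity, M, Real.exp (2 * M) * V, by positivity, a₁,
    lt_min hδ' (lt_min (by norm_num) (by positivity)), fun a ha => ?_, hupper,
    fun a ha b hb hab => ?_⟩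
  · obtain ⟨h2, h3, hpos, heq⟩ := hprop a ha
    have h4 := le_mul_of_truncated_exp_moment_eq_one hX hX1 hX2 hmean ha.1 hM0.le hpos
      (hupper a ha) heq
    rw [one_div_mul_eq_div, div_le_iff₀ (by positivity)]
    have hapos := ha.1
    have h5 : a ^ 2 ≤ 1 := by nlinarith
    have h6 : Real.exp M * θ a * (V + a ^ 2) ≤ Real.exp M * θ a * (V + 1) :=
      mul_le_mul_of_nonneg_left (by linarith) (by positivity)
    linarith
  · rcases hab.eq_or_lt with rfl | hlt
    · simp
    · obtain ⟨-, -, hposa, heqa⟩ := hprop a ha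
      obtain ⟨hb2, -, hposb, heqb⟩ := hprop b hb
      exact sub_le_mul_truncated_exp_moment_solution hX hX1 hX2 hmean ha.1 hlt (by linarith)
        hM0.le hposa hposb (hupper b hb) heqa heqb

/-- A tail function with `2 + ε` moments and exponent `g` forces `g` to grow faster than
`2 * log`. -/
theorem tendsto_sub_two_mul_log_of_moment {ε : ℝ} (hε : 0 < ε)
    (hmom : Integrable (fun ω => |X ω| ^ (2 + ε)) μ) {g : ℝ → ℝ}
    (htail : (fun x => μ.real {ω | x < X ω}) ~[atTop] fun x => Real.exp (-g x)) :
    Tendsto (fun x => g x - 2 * Real.log x) atTop atTop := by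
  set m := ∫ ω, |X ω| ^ (2 + ε) ∂μ with hm
  have hm0 : 0 ≤ m := integral_nonneg fun ω => by positivity
  have hO : ∀ᶠ x in atTop, Real.exp (-g x) ≤ 2 * μ.real {ω | x < X ω} := by
    have := (htail.isLittleO).def (c := 1 / 2) (by norm_num)
    filter_upwards [this] with x hx
    simp only [Pi.sub_apply, Real.norm_eq_abs, Real.abs_exp] at hx
    have := (abs_le.1 hx).1
    linarith
  have hbound : ∀ᶠ x in atTop, ε * Real.log x - Real.log (2 * (m + 1)) ≤
      g x - 2 * Real.log x := by
    filter_upwards [hO, eventually_gt_atTop 0] with x hx hx0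
    have hxp : 0 < x ^ (2 + ε) := Real.rpow_pos_of_pos hx0 _
    have h1 := mul_meas_ge_le_integral_of_nonneg (μ := μ)
      (Eventually.of_forall fun ω => (by positivity : 0 ≤ |X ω| ^ (2 + ε))) hmom (x ^ (2 + ε))
    have h2 : μ.real {ω | x < X ω} ≤ μ.real {ω | x ^ (2 + ε) ≤ |X ω| ^ (2 + ε)} := by
      refine measureReal_mono fun ω hω => ?_
      have hω' : x < X ω := hω
      exact Real.rpow_le_rpow hx0.le (hω'.le.trans (le_abs_self _)) (by positivity)
    have h3 : x ^ (2 + ε) * Real.exp (-g x) ≤ 2 * (m + 1) := by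
      have h4 := mul_le_mul_of_nonneg_left (hx.trans (mul_le_mul_of_nonneg_left h2 zero_le_two))
        hxp.le
      linarith
    have h5 := Real.log_le_log (by positivity) h3
    rw [Real.log_mul hxp.ne' (Real.exp_pos _).ne', Real.log_exp, Real.log_rpow hx0] at h5
    linarith
  refine tendsto_atTop_mono' _ hbound ?_
  exact tendsto_atTop_add_const_right _ _ (Real.tendsto_log_atTop.const_mul_atTop hε)

end ExpMoment

theorem tendsto_div_self_of_div_rpow_antitone {g : ℝ → ℝ} (hg : ∀ x, 0 < g x) {γ x₀ : ℝ}
    (hγ : γ < 1) (hx₀ : 0 < x₀)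
    (hmono : ∀ x y, x₀ ≤ x → x ≤ y → g y / y ^ γ ≤ g x / x ^ γ) :
    Tendsto (fun x => g x / x) atTop (𝓝 0) := by
  have h1 : Tendsto (fun x : ℝ => g x₀ / x₀ ^ γ * x ^ (-(1 - γ))) atTop (𝓝 0) := by
    simpa using (tendsto_rpow_neg_atTop (sub_pos.2 hγ)).const_mul (g x₀ / x₀ ^ γ)
  refine squeeze_zero' ?_ ?_ h1
  · filter_upwards [eventually_gt_atTop 0] with x hx using (div_pos (hg x) hx).le
  · filter_upwards [eventually_ge_atTop x₀] with x hx
    have hx0 : 0 < x := hx₀.trans_le hx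
    have hxp : 0 < x ^ γ := Real.rpow_pos_of_pos hx0 _
    have e : g x / x = g x / x ^ γ * x ^ (-(1 - γ)) := by
      rw [neg_sub, Real.rpow_sub hx0, Real.rpow_one]
      field_simp
    rw [e]
    exact mul_le_mul_of_nonneg_right (hmono x₀ x le_rfl hx) (Real.rpow_nonneg hx0.le _)

/-- Lemma 1, existence of the boundary sequence: under the stated assumptions on
`X`, `g` and `θ`, there exist `a₀ > 0` and a function `a ↦ x a` on `(0, a₀)` with `x a ≥ 1/a`,
`x` increasing as `a` decreases to `0`, such that
`θ a · x a − g (x a) − log (a · θ a) → 0` as `a → 0⁺`. -/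
theorem stmt0 {Ω : Type*} [MeasureSpace Ω] [IsProbabilityMeasure (ℙ : Measure Ω)]
    (X : Ω → ℝ) (hXmeas : Measurable X)
    (σ ε : ℝ) (hσ : 0 < σ) (hε : 0 < ε)
    (hmean : ∫ ω, X ω = 0)
    (hvar : ∫ ω, (X ω) ^ 2 = σ ^ 2)
    (hmom : Integrable (fun ω => |X ω| ^ (2 + ε)))
    (g : ℝ → ℝ) (hgpos : ∀ x, 0 < g x) (hgdiff : Differentiable ℝ g)
    (γ₀ x₀ : ℝ) (hγ₀ : γ₀ < 1) (hx₀ : 0 < x₀)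
    (hgmono : ∀ x y, x₀ ≤ x → x ≤ y → g y / y ^ γ₀ ≤ g x / x ^ γ₀)
    (htail : (fun x => (ℙ {ω | x < X ω}).toReal) ~[atTop] fun x => Real.exp (-g x))
    (θ : ℝ → ℝ) (hθpos : ∀ᶠ a in 𝓝[>] (0 : ℝ), 0 < θ a)
    (hθeq : ∀ᶠ a in 𝓝[>] (0 : ℝ),
      ∫ ω in {ω | X ω - a ≤ 1 / a}, Real.exp (θ a * (X ω - a)) = 1) :
    ∃ a₀ > (0 : ℝ), ∃ x : ℝ → ℝ,
      (∀ a ∈ Set.Ioo (0 : ℝ) a₀, 1 / a ≤ x a) ∧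
      (∀ a ∈ Set.Ioo (0 : ℝ) a₀, ∀ b ∈ Set.Ioo (0 : ℝ) a₀, a ≤ b → x b ≤ x a) ∧
      Tendsto (fun a => θ a * x a - g (x a) - Real.log (a * θ a)) (𝓝[>] 0) (𝓝 0) := by
  have hV : 0 < ∫ ω, (X ω) ^ 2 := by rw [hvar]; positivity
  have hX2 : Integrable (fun ω => (X ω) ^ 2) := Integrable.of_integral_ne_zero hV.ne'
  have hp : 0 < (ℙ : Measure Ω).real {ω | 1 < X ω} := by
    have hev := (htail.isLittleO).def (c := 1 / 2) (by norm_num)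
    obtain ⟨x, hx, hx1⟩ := (hev.and (eventually_ge_atTop 1)).exists
    simp only [Pi.sub_apply, Real.norm_eq_abs, Real.abs_exp] at hx
    have h1 := (abs_le.1 hx).1
    have h2 : (ℙ : Measure Ω).real {ω | x < X ω} ≤ (ℙ : Measure Ω).real {ω | 1 < X ω} :=
      measureReal_mono fun ω hω => lt_of_le_of_lt hx1 hω
    have h3 : (ℙ : Measure Ω).real {ω | x < X ω} = (ℙ {ω | x < X ω}).toReal := rfl
    have := Real.exp_pos (-g x)
    linarith
  obtain ⟨c, hc, M, L, hL, a₁, ha₁, hl, hu, hs⟩ :=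
    exists_linear_bounds_of_truncated_exp_moment hXmeas hX2 hV hmean hp hθpos hθeq
  exact exists_antitone_boundary hgdiff.continuous
    (tendsto_div_self_of_div_rpow_antitone hgpos hγ₀ hx₀ hgmono)
    (tendsto_sub_two_mul_log_of_moment hε hmom htail) hc hL ha₁ hl hu hs
end

section
/- As a → 0, any solution θ_a > 0 of the equation E[e^{θ_a X^{(a)}}; X^{(a)} ≤ 1/a] = 1 satisfies θ_a ~ 2a/σ². -/
open MeasureTheory ProbabilityTheory Filter Asymptotics Set Topology

lemma Real.exp_sub_one_sub_id_le_mul_sq {c t : ℝ} (hc : 0 ≤ c) (ht : t ≤ c) :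
    Real.exp t - 1 - t ≤ Real.exp c * t ^ 2 := by
  have h1 : Real.exp t - 1 ≤ t * Real.exp t := by
    have h := Real.add_one_le_exp (-t)
    have h2 : Real.exp t * Real.exp (-t) = 1 := by rw [← Real.exp_add]; simp
    nlinarith [Real.exp_pos t]
  have h3 : Real.exp t ≤ Real.exp c := Real.exp_le_exp.2 ht
  have h4 : 1 ≤ Real.exp c := Real.one_le_exp hc
  rcases le_total 0 t with h0 | h0
  · nlinarith [mul_le_mul_of_nonneg_left h1 h0, mul_le_mul_of_nonneg_left h3 (sq_nonneg t)]
  · have h5 := Real.add_one_le_exp t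
    nlinarith [mul_le_mul_of_nonpos_left h5 h0, mul_le_mul_of_nonneg_left h4 (sq_nonneg t)]

lemma tendsto_exp_taylor_two_div_sq (c x : ℝ) :
    Tendsto (fun a : ℝ => (Real.exp (c * a * (x - a)) - 1 - c * a * (x - a)) / a ^ 2)
      (𝓝[>] 0) (𝓝 (c ^ 2 * x ^ 2 / 2)) := by
  have ht : Tendsto (fun a : ℝ => c * a * (x - a)) (𝓝[>] 0) (𝓝 0) := by
    have h : Continuous fun a : ℝ => c * a * (x - a) := by fun_prop
    exact (h.tendsto' 0 0 (by simp)).mono_left nhdsWithin_le_nhds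
  have hO := (Real.exp_sub_sum_range_isBigO_pow 3).comp_tendsto ht
  have hO2 := hO.mul (isBigO_refl (fun a : ℝ => (a ^ 2)⁻¹) (𝓝[>] 0))
  have hz : Tendsto (fun a : ℝ => ((fun y : ℝ => y ^ 3) ∘ fun a : ℝ => c * a * (x - a)) a
      * (a ^ 2)⁻¹) (𝓝[>] 0) (𝓝 0) := by
    have h : Continuous fun a : ℝ => a * (c * (x - a)) ^ 3 := by fun_prop
    refine ((h.tendsto' 0 0 (by simp)).mono_left nhdsWithin_le_nhds).congr' ?_
    filter_upwards [self_mem_nhdsWithin] with a (ha : 0 < a)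
    simp only [Function.comp]
    field_simp
  have hq : Tendsto (fun a : ℝ => c ^ 2 * (x - a) ^ 2 / 2) (𝓝[>] 0) (𝓝 (c ^ 2 * x ^ 2 / 2)) := by
    have h : Continuous fun a : ℝ => c ^ 2 * (x - a) ^ 2 / 2 := by fun_prop
    exact (h.tendsto' 0 _ (by simp)).mono_left nhdsWithin_le_nhds
  have := (hO2.trans_tendsto hz).add hq
  rw [zero_add] at this
  refine this.congr' ?_
  filter_upwards [self_mem_nhdsWithin] with a (ha : 0 < a)
  simp only [Function.comp, Finset.sum_range_succ, Finset.sum_range_zero, Nat.factorial]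
  field_simp
  push_cast
  ring

section TruncatedMGF

variable {Ω : Type*} [MeasurableSpace Ω] {μ : Measure Ω} {X : Ω → ℝ}

/-- The moment generating function at `t` of `X - a` truncated to `X - a ≤ 1 / a`. -/
noncomputable def truncatedMGF (μ : Measure Ω) (X : Ω → ℝ) (a t : ℝ) : ℝ :=
  ∫ ω in {ω | X ω - a ≤ 1 / a}, Real.exp (t * (X ω - a)) ∂μ

lemma measurableSet_sub_le (hX : Measurable X) (a b : ℝ) :
    MeasurableSet {ω | X ω - a ≤ b} :=
  measurableSet_le (hX.sub_const a) measurable_const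

lemma integrableOn_exp_mul_sub [IsFiniteMeasure μ] (hX : Measurable X) (a b : ℝ) {t : ℝ}
    (ht : 0 ≤ t) :
    IntegrableOn (fun ω => Real.exp (t * (X ω - a))) {ω | X ω - a ≤ b} μ := by
  refine Measure.integrableOn_of_bounded (M := Real.exp (t * b)) (measure_ne_top _ _)
    (by fun_prop) ?_
  filter_upwards [ae_restrict_mem (measurableSet_sub_le hX a b)] with ω hω
  rw [Real.norm_eq_abs, Real.abs_exp]
  exact Real.exp_le_exp.2 (mul_le_mul_of_nonneg_left hω ht)

lemma truncatedMGF_zero_le_one [IsProbabilityMeasure μ] (a : ℝ) :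
    truncatedMGF μ X a 0 ≤ 1 := by
  simp [truncatedMGF, measureReal_le_one]

lemma convexOn_truncatedMGF [IsFiniteMeasure μ] (hX : Measurable X) (a : ℝ) :
    ConvexOn ℝ (Ici 0) (truncatedMGF μ X a) := by
  refine ⟨convex_Ici 0, fun s hs t ht p q hp hq hpq => ?_⟩
  have is := integrableOn_exp_mul_sub (μ := μ) hX a (1 / a) hs
  have it := integrableOn_exp_mul_sub (μ := μ) hX a (1 / a) ht
  simp only [truncatedMGF, smul_eq_mul]
  rw [← integral_const_mul, ← integral_const_mul,
    ← integral_add (is.const_mul p) (it.const_mul q)]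
  refine integral_mono (integrableOn_exp_mul_sub hX a (1 / a)
    (add_nonneg (mul_nonneg hp hs) (mul_nonneg hq ht)))
    ((is.const_mul p).add (it.const_mul q)) fun ω => ?_
  have := convexOn_exp.2 (mem_univ (s * (X ω - a))) (mem_univ (t * (X ω - a))) hp hq hpq
  simp only [smul_eq_mul] at this
  convert this using 2
  ring

/-- Second-order expansion of the truncated moment generating function at arguments of order `a`. -/
lemma tendsto_truncatedMGF_sub_one_div_sq [IsProbabilityMeasure μ] (hX : Measurable X)
    (hX2 : MemLp X 2 μ) (hmean : ∫ ω, X ω ∂μ = 0) {c : ℝ} (hc : 0 < c) :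
    Tendsto (fun a => (truncatedMGF μ X a (c * a) - 1) / a ^ 2) (𝓝[>] 0)
      (𝓝 (c ^ 2 * (∫ ω, X ω ^ 2 ∂μ) / 2 - c)) := by
  have hXi : Integrable X μ := hX2.integrable one_le_two
  have hsq : Integrable (fun ω => X ω ^ 2) μ := hX2.integrable_sq
  let g : ℝ → Ω → ℝ := fun a ω =>
    ({ω | X ω - a ≤ 1 / a}.indicator (fun ω => Real.exp (c * a * (X ω - a))) ω
      - 1 - c * a * (X ω - a)) / a ^ 2
  set K : ℝ := Real.exp c * c ^ 2 + 1 + c with hK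
  have hlim : Tendsto (fun a => ∫ ω, g a ω ∂μ) (𝓝[>] 0)
      (𝓝 (∫ ω, c ^ 2 * X ω ^ 2 / 2 ∂μ)) := by
    refine tendsto_integral_filter_of_dominated_convergence
      (fun ω => K * (2 * (X ω ^ 2 + 1))) ?_ ?_ ?_ ?_
    · refine Eventually.of_forall fun a => Measurable.aestronglyMeasurable ?_
      have := (Real.measurable_exp.comp ((hX.sub_const a).const_mul (c * a))).indicator
        (measurableSet_sub_le hX a (1 / a))
      exact ((this.sub_const 1).sub ((hX.sub_const a).const_mul (c * a))).div_const _
    · filter_upwards [self_mem_nhdsWithin, nhdsWithin_le_nhds (Iio_mem_nhds one_pos)]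
        with a (ha : 0 < a) (ha1 : a < 1)
      refine Eventually.of_forall fun ω => ?_
      have hY : (X ω - a) ^ 2 ≤ 2 * (X ω ^ 2 + 1) := by nlinarith [sq_nonneg (X ω + a)]
      refine le_trans ?_ (mul_le_mul_of_nonneg_left hY (by positivity : 0 ≤ K))
      rw [Real.norm_eq_abs, abs_div, abs_of_pos (by positivity : 0 < a ^ 2),
        div_le_iff₀ (by positivity)]
      by_cases h : X ω - a ≤ 1 / a
      · rw [indicator_of_mem (by exact h)]
        rw [le_div_iff₀ ha] at h
        have h1 := Real.exp_sub_one_sub_id_le_mul_sq (c := c) (t := c * a * (X ω - a)) hc.le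
          (by nlinarith)
        rw [abs_of_nonneg (by linarith [Real.add_one_le_exp (c * a * (X ω - a))])]
        refine h1.trans ?_
        have : 0 ≤ (1 + c) * ((X ω - a) ^ 2 * a ^ 2) := by positivity
        rw [hK]; linarith
      · rw [indicator_of_notMem (by exact h)]
        rw [not_le, div_lt_iff₀ ha] at h
        have h2 : (X ω - a) * a ≤ ((X ω - a) * a) ^ 2 := by nlinarith
        have h3 : 0 ≤ Real.exp c * c ^ 2 * ((X ω - a) * a) ^ 2 := by positivity
        rw [abs_of_nonpos (by nlinarith), hK]
        nlinarith [mul_le_mul_of_nonneg_left h2 hc.le]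
    · exact ((hsq.add (integrable_const 1)).const_mul 2).const_mul K
    · refine Eventually.of_forall fun ω => ?_
      refine (tendsto_exp_taylor_two_div_sq c (X ω)).congr' ?_
      have h : Tendsto (fun a : ℝ => X ω - a - a⁻¹) (𝓝[>] 0) atBot := by
        have h1 : Tendsto (fun a : ℝ => X ω - a) (𝓝[>] 0) (𝓝 (X ω)) :=
          ((continuous_const.sub continuous_id).tendsto' 0 _ (by simp)).mono_left
            nhdsWithin_le_nhds
        simpa [sub_eq_add_neg] using
          h1.add_atBot (tendsto_neg_atTop_atBot.comp tendsto_inv_nhdsGT_zero)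
      filter_upwards [h.eventually_le_atBot 0] with a ha
      have hmem : ω ∈ {ω | X ω - a ≤ 1 / a} := by
        rw [mem_ofPred_eq, one_div]; linarith
      simp only [g, indicator_of_mem hmem]
  have hlim' := hlim.sub_const c
  have hval : ∫ ω, c ^ 2 * X ω ^ 2 / 2 ∂μ = c ^ 2 * (∫ ω, X ω ^ 2 ∂μ) / 2 := by
    rw [integral_div, integral_const_mul]
  rw [hval] at hlim'
  refine hlim'.congr' ?_
  filter_upwards [self_mem_nhdsWithin] with a (ha : 0 < a)
  have hs := measurableSet_sub_le hX a (1 / a)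
  have hexp := (integrable_indicator_iff hs).2
    (integrableOn_exp_mul_sub (μ := μ) hX a (1 / a) (t := c * a) (by positivity))
  have hlin : Integrable (fun ω => c * a * (X ω - a)) μ :=
    (hXi.sub (integrable_const a)).const_mul _
  have hg : ∫ ω, g a ω ∂μ = (truncatedMGF μ X a (c * a) - 1 + c * a ^ 2) / a ^ 2 := by
    simp only [g]
    have hexp1 : Integrable (fun ω => {ω | X ω - a ≤ 1 / a}.indicator
        (fun ω => Real.exp (c * a * (X ω - a))) ω - 1) μ := hexp.sub (integrable_const 1)
    rw [integral_div, integral_sub hexp1 hlin,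
      integral_sub hexp (integrable_const 1), integral_indicator hs, integral_const_mul,
      integral_sub hXi (integrable_const a), hmean]
    simp only [truncatedMGF, integral_const, probReal_univ, one_smul]
    ring
  rw [hg]
  field_simp
  ring

end TruncatedMGF

/-- as `a → 0⁺`, any solution `θ a > 0` of
`E[e^{θ a · X^{(a)}}; X^{(a)} ≤ 1/a] = 1`, where `X^{(a)} = X − a`, satisfies
`θ a ~ 2a/σ²`. -/
theorem stmt3 {Ω : Type*} [MeasureSpace Ω] [IsProbabilityMeasure (ℙ : Measure Ω)]
    (X : Ω → ℝ) (hXmeas : Measurable X)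
    (σ ε : ℝ) (hσ : 0 < σ) (hε : 0 < ε)
    (hmean : ∫ ω, X ω = 0)
    (hvar : ∫ ω, (X ω) ^ 2 = σ ^ 2)
    (hmom : Integrable (fun ω => |X ω| ^ (2 + ε)))
    (θ : ℝ → ℝ) (hθpos : ∀ᶠ a in 𝓝[>] (0 : ℝ), 0 < θ a)
    (hθeq : ∀ᶠ a in 𝓝[>] (0 : ℝ),
      ∫ ω in {ω | X ω - a ≤ 1 / a}, Real.exp (θ a * (X ω - a)) = 1) :
    θ ~[𝓝[>] (0 : ℝ)] fun a => 2 * a / σ ^ 2 := by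
  have hX2 : MemLp X 2 := by
    refine (memLp_two_iff_integrable_sq hXmeas.aestronglyMeasurable).2 ?_
    exact Integrable.of_integral_ne_zero (by rw [hvar]; positivity)
  have hσ2 : 0 < σ ^ 2 := by positivity
  have hne : ∀ᶠ a in 𝓝[>] (0 : ℝ), 2 * a / σ ^ 2 ≠ 0 := by
    filter_upwards [self_mem_nhdsWithin] with a (ha : 0 < a)
    positivity
  have hlower : ∀ c > 0, c < 2 / σ ^ 2 → ∀ᶠ a in 𝓝[>] (0 : ℝ), c * a < θ a := by
    intro c hc hc2
    have h := tendsto_truncatedMGF_sub_one_div_sq hXmeas hX2 hmean hc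
    rw [lt_div_iff₀ hσ2] at hc2
    filter_upwards [h.eventually_lt_const (show _ < (0 : ℝ) by rw [hvar]; nlinarith), hθpos,
      hθeq, self_mem_nhdsWithin] with a hneg hθ heq (ha : 0 < a)
    have hca : 0 < c * a := by positivity
    have hlt : truncatedMGF ℙ X a (c * a) < 1 := by
      by_contra! hge
      exact hneg.not_ge (div_nonneg (by linarith) (by positivity))
    by_contra! hle
    have hconv := (convexOn_truncatedMGF (μ := ℙ) hXmeas a).2 (mem_Ici.2 le_rfl)
      (mem_Ici.2 hca.le) (sub_nonneg.2 ((div_le_one hca).2 hle)) (div_pos hθ hca).le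
      (sub_add_cancel _ _)
    have heq' : truncatedMGF ℙ X a (θ a) = 1 := heq
    simp only [smul_eq_mul, mul_zero, zero_add, div_mul_cancel₀ _ hca.ne', heq'] at hconv
    have h0 := truncatedMGF_zero_le_one (μ := ℙ) (X := X) a
    nlinarith [mul_le_mul_of_nonneg_left h0 (sub_nonneg.2 ((div_le_one hca).2 hle)),
      mul_lt_mul_of_pos_left hlt (div_pos hθ hca)]
  have hupper : ∀ c > 2 / σ ^ 2, ∀ᶠ a in 𝓝[>] (0 : ℝ), θ a < c * a := by
    intro c hc2
    have hc : 0 < c := lt_trans (by positivity) hc2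
    have h := tendsto_truncatedMGF_sub_one_div_sq hXmeas hX2 hmean hc
    rw [gt_iff_lt, div_lt_iff₀ hσ2] at hc2
    filter_upwards [h.eventually_const_lt (show (0 : ℝ) < _ by rw [hvar]; nlinarith), hθpos,
      hθeq, self_mem_nhdsWithin] with a hpos hθ heq (ha : 0 < a)
    have hgt : 1 < truncatedMGF ℙ X a (c * a) := by
      by_contra! hge
      exact hpos.not_ge (div_nonpos_of_nonpos_of_nonneg (by linarith) (by positivity))
    by_contra! hle
    have hmax := (convexOn_truncatedMGF (μ := ℙ) hXmeas a).le_max_of_mem_Icc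
      (mem_Ici.2 le_rfl) (mem_Ici.2 hθ.le) ⟨(by positivity : 0 ≤ c * a), hle⟩
    have heq' : truncatedMGF ℙ X a (θ a) = 1 := heq
    rw [heq', max_eq_right (truncatedMGF_zero_le_one a)] at hmax
    exact hgt.not_ge hmax
  refine (isEquivalent_iff_tendsto_one hne).2 (tendsto_order.2 ⟨fun b hb => ?_, fun b hb => ?_⟩)
  · have hm : max b (1 / 2) < 1 := max_lt hb (by norm_num)
    have hm0 : (0 : ℝ) < max b (1 / 2) := lt_max_of_lt_right (by norm_num)
    filter_upwards [hlower (max b (1 / 2) * (2 / σ ^ 2)) (by positivity)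
      (mul_lt_of_lt_one_left (by positivity) hm), self_mem_nhdsWithin] with a h (ha : 0 < a)
    refine (le_max_left b (1 / 2)).trans_lt ((lt_div_iff₀ (by positivity)).2 ?_)
    exact (show max b (1 / 2) * (2 * a / σ ^ 2) = max b (1 / 2) * (2 / σ ^ 2) * a by
      ring).trans_lt h
  · filter_upwards [hupper (b * (2 / σ ^ 2)) (lt_mul_of_one_lt_left (by positivity) hb),
      self_mem_nhdsWithin] with a h (ha : 0 < a)
    refine (div_lt_iff₀ (by positivity)).2 ?_
    exact h.trans_eq (by ring)
end

section
/- Let γ ∈ (0,1], t₀ > 0, and let g : [t₀, ∞) → (0, ∞) be such that x ↦ g(x)/x^γ is nondecreasing on [t₀, ∞). Then for all t and w with 0 ≤ w < t and t − w ≥ t₀ one has g(t) − g(t−w) ≥ γ·w·g(t)/t. -/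
open Filter Set

/-- If `g : [t₀, ∞) → (0, ∞)` is such that `x ↦ g x / x ^ γ` is nondecreasing on
`[t₀, ∞)` for some `γ ∈ (0,1]`, then for all `t, w` with `0 ≤ w < t` and `t₀ ≤ t - w` one has
`g t - g (t - w) ≥ γ * w * g t / t`. -/
theorem stmt9 (γ t₀ : ℝ) (hγ : γ ∈ Set.Ioc (0 : ℝ) 1) (ht₀ : 0 < t₀)
    (g : ℝ → ℝ) (hgpos : ∀ x, t₀ ≤ x → 0 < g x)
    (hgmono : ∀ x y, t₀ ≤ x → x ≤ y → g x / x ^ γ ≤ g y / y ^ γ) :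
    ∀ t w : ℝ, 0 ≤ w → w < t → t₀ ≤ t - w →
      γ * w * g t / t ≤ g t - g (t - w) := by
  intro t w hw hwt ht
  have ht_pos : 0 < t := by linarith
  have hs_pos : 0 < t - w := by linarith
  have bernoulli : ((t - w) / t) ^ γ ≤ 1 + γ * (-(w / t)) := by
    have h := rpow_one_add_le_one_add_mul_self (s := -(w / t))
      (by linarith [(div_lt_one ht_pos).2 hwt]) hγ.1.le hγ.2
    rwa [show 1 + -(w / t) = (t - w) / t by field_simp; ring] at h
  have hg : g (t - w) ≤ g t * ((t - w) / t) ^ γ := by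
    have h := hgmono (t - w) t ht (by linarith)
    rw [div_le_iff₀ (Real.rpow_pos_of_pos hs_pos γ)] at h
    rw [Real.div_rpow hs_pos.le ht_pos.le]
    calc g (t - w) ≤ g t / t ^ γ * (t - w) ^ γ := h
      _ = g t * ((t - w) ^ γ / t ^ γ) := by ring
  have hmul := mul_le_mul_of_nonneg_left bernoulli (hgpos t (by linarith)).le
  calc γ * w * g t / t = g t - g t * (1 + γ * (-(w / t))) := by ring
    _ ≤ g t - g (t - w) := by linarith
end

section
/- Let g : [x₀, ∞) → ℝ be differentiable with g(x) → ∞ as x → ∞, g'(x) > 0 for all large x, and (1/g')'(x) → 0 as x → ∞. Then u ↦ e^{−g(u)} is integrable on [x, ∞) for large x, and ∫_x^∞ e^{−g(u)} du ~ e^{−g(x)}/g'(x) as x → ∞. In particular, if F̄(x) = e^{−g(x)} is the tail of a distribution function with such a g, then F̄^I(x)/F̄(x) ~ 1/g'(x) as x → ∞. -/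
open MeasureTheory Filter Asymptotics Set Topology

/-- If `g' = 1 / h` with `h > 0` and `h' → 0`, then `e^{-g} h` vanishes at infinity
as soon as `g` tends to infinity. -/
lemma tendsto_exp_neg_mul_zero {g h h' : ℝ → ℝ} {a : ℝ}
    (hg : ∀ x, a ≤ x → HasDerivAt g (h x)⁻¹ x) (hpos : ∀ x, a ≤ x → 0 < h x)
    (hh : ∀ x, a ≤ x → HasDerivAt h (h' x) x) (hh' : ∀ x, a ≤ x → h' x ≤ 1 / 2)
    (hginf : Tendsto g atTop atTop) :
    Tendsto (fun x => Real.exp (-g x) * h x) atTop (𝓝 0) := by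
  set ψ : ℝ → ℝ := fun x => Real.exp (-g x / 2) * h x with hψ_def
  have hψ : ∀ x, a ≤ x → HasDerivAt ψ (Real.exp (-g x / 2) * (h' x - 1 / 2)) x := by
    intro x hx
    have hne := (hpos x hx).ne'
    refine (((hg x hx).neg.div_const 2).exp.mul (hh x hx)).congr_deriv ?_
    simp only [Pi.neg_apply]
    field_simp
    ring
  have hanti : AntitoneOn ψ (Ici a) := by
    refine antitoneOn_of_deriv_nonpos (convex_Ici a)
      (fun x hx => (hψ x hx).continuousAt.continuousWithinAt)
      (fun x hx => (hψ x (interior_subset hx)).differentiableAt.differentiableWithinAt) ?_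
    intro x hx
    have hx' : a ≤ x := interior_subset hx
    rw [(hψ x hx').deriv]
    exact mul_nonpos_of_nonneg_of_nonpos (Real.exp_pos _).le (by linarith [hh' x hx'])
  have hexp : Tendsto (fun x => Real.exp (-g x / 2) * ψ a) atTop (𝓝 0) := by
    have : Tendsto (fun x => -g x / 2) atTop atBot :=
      (tendsto_neg_atTop_atBot.comp hginf).atBot_div_const two_pos
    simpa using (Real.tendsto_exp_atBot.comp this).mul_const (ψ a)
  refine squeeze_zero' ?_ ?_ hexp
  · filter_upwards [eventually_ge_atTop a] with x hx
    exact (mul_pos (Real.exp_pos _) (hpos x hx)).le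
  · filter_upwards [eventually_ge_atTop a] with x hx
    have hsplit : Real.exp (-g x) * h x = Real.exp (-g x / 2) * ψ x := by
      rw [hψ_def, ← mul_assoc, ← Real.exp_add, add_halves]
    rw [hsplit]
    exact mul_le_mul_of_nonneg_left (hanti self_mem_Ici hx hx) (Real.exp_pos _).le

/-- Integrability of `e^{-g}` and the integrated form of `(e^{-g} h)' = e^{-g} (h' - 1)`,
where `g' = 1 / h`. -/
lemma integrableOn_exp_neg_and_integral_eq {g h h' : ℝ → ℝ} {a : ℝ}
    (hg : ∀ x, a ≤ x → HasDerivAt g (h x)⁻¹ x) (hpos : ∀ x, a ≤ x → 0 < h x)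
    (hh : ∀ x, a ≤ x → HasDerivAt h (h' x) x) (hh' : ∀ x, a ≤ x → h' x ≤ 1 / 2)
    (hginf : Tendsto g atTop atTop) {x : ℝ} (hx : a ≤ x) :
    IntegrableOn (fun u => Real.exp (-g u)) (Ioi x) ∧
      IntegrableOn (fun u => Real.exp (-g u) * (h' u - 1)) (Ioi x) ∧
      ∫ u in Ioi x, Real.exp (-g u) * (h' u - 1) = -(Real.exp (-g x) * h x) := by
  have hφ : ∀ u, a ≤ u →
      HasDerivAt (fun u => Real.exp (-g u) * h u) (Real.exp (-g u) * (h' u - 1)) u := by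
    intro u hu
    have hne := (hpos u hu).ne'
    refine ((hg u hu).neg.exp.mul (hh u hu)).congr_deriv ?_
    simp only [Pi.neg_apply]
    field_simp
    ring
  have hlim := tendsto_exp_neg_mul_zero hg hpos hh hh' hginf
  have hint : IntegrableOn (fun u => Real.exp (-g u) * (h' u - 1)) (Ioi x) :=
    integrableOn_Ioi_deriv_of_nonpos' (fun u hu => hφ u (hx.trans hu))
      (fun u hu => mul_nonpos_of_nonneg_of_nonpos (Real.exp_pos _).le
        (by linarith [hh' u (hx.trans (le_of_lt hu))])) hlim
  refine ⟨?_, hint, ?_⟩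
  · have hcont : ContinuousOn (fun u => Real.exp (-g u)) (Ioi x) := fun u hu =>
      (hg u (hx.trans (le_of_lt hu))).neg.exp.continuousAt.continuousWithinAt
    refine (hint.const_mul (-2)).mono' (hcont.aestronglyMeasurable measurableSet_Ioi) ?_
    refine (ae_restrict_iff' measurableSet_Ioi).2 (Eventually.of_forall fun u hu => ?_)
    rw [Real.norm_eq_abs, abs_of_pos (Real.exp_pos _)]
    nlinarith [Real.exp_pos (-g u), hh' u (hx.trans (le_of_lt hu))]
  · rw [integral_Ioi_of_hasDerivAt_of_tendsto' (fun u hu => hφ u (hx.trans hu)) hint hlim,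
      zero_sub]



/-- if `g` is differentiable on `[x₀, ∞)` with `g x → ∞`, `g' x > 0` for all
large `x`, and `(1/g')' x → 0` as `x → ∞`, then `u ↦ e^{-g u}` is integrable on `[x, ∞)` for
large `x` and `∫_x^∞ e^{-g u} du ~ e^{-g x}/g' x`.  In particular, for the tail
`F̄ = e^{-g}` one has `F̄^I x / F̄ x ~ 1 / g' x` as `x → ∞`. -/
theorem stmt12 (x₀ : ℝ) (hx₀ : 0 < x₀) (g : ℝ → ℝ)
    (hdiff : ∀ x, x₀ ≤ x → DifferentiableAt ℝ g x)
    (hginf : Tendsto g atTop atTop)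
    (hderiv_pos : ∀ᶠ x in atTop, 0 < deriv g x)
    (hinvdiff : ∀ᶠ x in atTop, DifferentiableAt ℝ (fun y => (deriv g y)⁻¹) x)
    (hinv : Tendsto (fun x => deriv (fun y => (deriv g y)⁻¹) x) atTop (𝓝 0)) :
    (∀ᶠ x in atTop, IntegrableOn (fun u => Real.exp (-g u)) (Set.Ioi x)) ∧
    ((fun x => ∫ u in Set.Ioi x, Real.exp (-g u)) ~[atTop]
      fun x => Real.exp (-g x) / deriv g x) ∧
    ((fun x => (∫ u in Set.Ioi x, Real.exp (-g u)) / Real.exp (-g x)) ~[atTop]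
      fun x => (deriv g x)⁻¹) := by
  set h : ℝ → ℝ := fun y => (deriv g y)⁻¹ with h_def
  have hsmall : ∀ᶠ x in atTop, deriv h x ≤ 1 / 2 := hinv.eventually_le_const (by norm_num)
  obtain ⟨a, ha⟩ := eventually_atTop.1
    (((eventually_ge_atTop x₀).and hderiv_pos).and (hinvdiff.and hsmall))
  have hg : ∀ x, a ≤ x → HasDerivAt g (h x)⁻¹ x := fun x hx => by
    simpa [h_def] using (hdiff x (ha x hx).1.1).hasDerivAt
  have hpos : ∀ x, a ≤ x → 0 < h x := fun x hx => inv_pos.2 (ha x hx).1.2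
  have key := fun x (hx : a ≤ x) => integrableOn_exp_neg_and_integral_eq hg hpos
    (fun x hx => (ha x hx).2.1.hasDerivAt) (fun x hx => (ha x hx).2.2) hginf hx
  have hequiv : (fun x => ∫ u in Ioi x, Real.exp (-g u)) ~[atTop]
      fun x => Real.exp (-g x) / deriv g x := by
    refine IsEquivalent.symm (isLittleO_iff.2 fun ε hε => ?_)
    have hε' : ∀ᶠ x in atTop, ‖deriv h x‖ ≤ ε :=
      (tendsto_zero_iff_norm_tendsto_zero.1 hinv).eventually_le_const hε
    filter_upwards [eventually_ge_atTop a, eventually_forall_ge_atTop.2 hε'] with x hx hxε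
    obtain ⟨hint, hint', heq⟩ := key x hx
    have hdiff_eq : Real.exp (-g x) / deriv g x - ∫ u in Ioi x, Real.exp (-g u) =
        -∫ u in Ioi x, Real.exp (-g u) * deriv h u := by
      have hadd := integral_add hint' hint
      rw [heq] at hadd
      have hcongr : ∀ u, Real.exp (-g u) * (deriv h u - 1) + Real.exp (-g u) =
          Real.exp (-g u) * deriv h u := fun u => by ring
      simp only [hcongr] at hadd
      rw [hadd, div_eq_mul_inv]
      ring
    have hnonneg : 0 ≤ ∫ u in Ioi x, Real.exp (-g u) :=
      integral_nonneg fun u => (Real.exp_pos _).le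
    rw [Pi.sub_apply, hdiff_eq, norm_neg, Real.norm_of_nonneg hnonneg, ← integral_const_mul]
    refine norm_integral_le_of_norm_le (hint.const_mul ε)
      ((ae_restrict_iff' measurableSet_Ioi).2 (Eventually.of_forall fun u hu => ?_))
    rw [norm_mul, Real.norm_of_nonneg (Real.exp_pos _).le, mul_comm]
    exact mul_le_mul_of_nonneg_right (hxε u (le_of_lt hu)) (Real.exp_pos _).le
  refine ⟨?_, hequiv, ?_⟩
  · filter_upwards [eventually_ge_atTop a] with x hx using (key x hx).1
  · refine (hequiv.div (IsEquivalent.refl (u := fun x => Real.exp (-g x)))).congr_right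
      (Eventually.of_forall fun x => ?_)
    simp only [h_def, Pi.div_apply]
    field_simp
end

section
/- Assume in addition that g(t)/t^{ε₁} → ∞ as t → ∞ for some ε₁ ∈ (0,1). Then, as a → 0, g(x(a))/(θ_a·x(a)) → 1, and x(a)·θ_a^{1/(1−ε₁)} → ∞ (i.e. x(a) ≫ (1/θ_a)^{1/(1−ε₁)}). -/
open MeasureTheory ProbabilityTheory Filter Asymptotics Set Topology

/-- `exp u` lies below its second-order bound `1 + u + u ^ 2` for `u ≤ 1`. -/
theorem exp_le_one_add_add_sq {u : ℝ} (hu : u ≤ 1) : Real.exp u ≤ 1 + u + u ^ 2 := by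
  rcases le_or_gt (-1) u with h | h
  · have := Real.abs_exp_sub_one_sub_id_le (abs_le.2 ⟨h, hu⟩)
    linarith [le_abs_self (Real.exp u - 1 - u)]
  · have : Real.exp u ≤ 1 := Real.exp_le_one_iff.2 (by linarith)
    nlinarith

/-- The positive root `θ` of the truncated exponential-moment equation for `X - a` with `X` centred
is at least of order `a`. -/
theorem div_add_one_le_of_truncated_exp_moment_eq_one {Ω : Type*} [MeasurableSpace Ω]
    {μ : Measure Ω} [IsProbabilityMeasure μ] {X : Ω → ℝ} (hX : Measurable X)
    {v a θ : ℝ} (hv : 0 < v) (hmean : ∫ ω, X ω ∂μ = 0) (hvar : ∫ ω, (X ω) ^ 2 ∂μ = v)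
    (ha : 0 < a) (ha1 : a ≤ 1) (hθ : 0 < θ)
    (h : ∫ ω in {ω | X ω - a ≤ 1 / a}, Real.exp (θ * (X ω - a)) ∂μ = 1) :
    a / (v + 1) ≤ θ := by
  rw [div_le_iff₀ (by linarith)]
  rcases le_or_gt a θ with hθa | hθa
  · nlinarith
  have hX2 : Integrable (fun ω => (X ω) ^ 2) μ := by
    by_contra hn
    rw [integral_undef hn] at hvar
    exact hv.ne hvar
  have hX1 : Integrable X μ :=
    ((memLp_two_iff_integrable_sq hX.aestronglyMeasurable).2 hX2).integrable one_le_two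
  have hs : MeasurableSet {ω | X ω - a ≤ 1 / a} :=
    measurableSet_le (hX.sub_const a) measurable_const
  have hexp : IntegrableOn (fun ω => Real.exp (θ * (X ω - a))) {ω | X ω - a ≤ 1 / a} μ := by
    by_contra hn
    rw [integral_undef hn] at h
    exact zero_ne_one h
  have hlin : Integrable (fun ω => (1 - θ * a + θ ^ 2 * a ^ 2) + (θ - 2 * θ ^ 2 * a) * X ω) μ :=
    (integrable_const _).add (hX1.const_mul _)
  have hquad : Integrable (fun ω => θ ^ 2 * X ω ^ 2) μ := hX2.const_mul _
  have hle : ∫ ω in {ω | X ω - a ≤ 1 / a}, Real.exp (θ * (X ω - a)) ∂μ ≤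
      ∫ ω, ((1 - θ * a + θ ^ 2 * a ^ 2) + (θ - 2 * θ ^ 2 * a) * X ω) + θ ^ 2 * X ω ^ 2 ∂μ := by
    rw [← integral_indicator hs]
    refine integral_mono (hexp.integrable_indicator hs) (hlin.add hquad) fun ω => ?_
    by_cases hω : X ω - a ≤ 1 / a
    · rw [indicator_of_mem (by exact hω)]
      have hu : θ * (X ω - a) ≤ 1 := by
        calc θ * (X ω - a) ≤ θ * (1 / a) := by gcongr
          _ ≤ a * (1 / a) := by gcongr
          _ = 1 := by field_simp
      refine (exp_le_one_add_add_sq hu).trans (le_of_eq ?_)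
      ring
    · rw [indicator_of_notMem (by exact hω)]
      have hpos : 0 ≤ X ω - a := le_trans (by positivity) (not_le.1 hω).le
      nlinarith [mul_nonneg hθ.le hpos, sq_nonneg (θ * (X ω - a))]
  rw [h, integral_add hlin hquad, integral_add (integrable_const _) (hX1.const_mul _),
    integral_const_mul, integral_const_mul, hmean, hvar] at hle
  simp only [integral_const, probReal_univ, one_smul, mul_zero, add_zero] at hle
  have hkey : θ * a ≤ θ * (θ * (v + a ^ 2)) := by nlinarith
  have hle' := le_of_mul_le_mul_left hkey hθ
  nlinarith [mul_nonneg hθ.le (sub_nonneg.2 (pow_le_one₀ ha.le ha1 : a ^ 2 ≤ 1))]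

/-- A function dominating a positive power dominates every affine function of `log`. -/
theorem tendsto_affine_log_div_of_rpow_le {g : ℝ → ℝ} {s : ℝ} (hs : 0 < s)
    (hg : Tendsto (fun t => g t / t ^ s) atTop atTop) (b c : ℝ) :
    Tendsto (fun t => (b * Real.log t + c) / g t) atTop (𝓝 0) := by
  have hlog : Tendsto (fun t : ℝ => (b * Real.log t + c) / t ^ s) atTop (𝓝 0) :=
    (((isLittleO_log_rpow_atTop hs).const_mul_left b).add
      ((isLittleO_const_left (c := c)).2
        (Or.inr (tendsto_norm_atTop_atTop.comp (tendsto_rpow_atTop hs))))).tendsto_div_nhds_zero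
  have := hlog.mul hg.inv_tendsto_atTop
  rw [zero_mul] at this
  refine this.congr' ?_
  filter_upwards [eventually_gt_atTop 0] with t ht
  have : t ^ s ≠ 0 := (Real.rpow_pos_of_pos ht s).ne'
  simp only [Pi.inv_apply, inv_div]
  rw [div_mul_div_cancel₀ this]

/-- if in addition `g t / t^{ε₁} → ∞` for some `ε₁ ∈ (0,1)`, then as `a → 0⁺`
one has `g(x(a))/(θ_a·x(a)) → 1` and `x(a)·θ_a^{1/(1−ε₁)} → ∞`, i.e.
`x(a) ≫ (1/θ_a)^{1/(1−ε₁)}`. -/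
theorem stmt17 {Ω : Type*} [MeasureSpace Ω] [IsProbabilityMeasure (ℙ : Measure Ω)]
    (X : Ω → ℝ) (hXmeas : Measurable X)
    (σ ε : ℝ) (hσ : 0 < σ) (hε : 0 < ε)
    (hmean : ∫ ω, X ω = 0)
    (hvar : ∫ ω, (X ω) ^ 2 = σ ^ 2)
    (hmom : Integrable (fun ω => |X ω| ^ (2 + ε)))
    (g : ℝ → ℝ) (hgpos : ∀ x, 0 < g x) (hgdiff : Differentiable ℝ g)
    (γ₀ x₀ : ℝ) (hγ₀ : γ₀ < 1) (hx₀ : 0 < x₀)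
    (hgmono : ∀ x y, x₀ ≤ x → x ≤ y → g y / y ^ γ₀ ≤ g x / x ^ γ₀)
    (htail : (fun x => (ℙ {ω | x < X ω}).toReal) ~[atTop] fun x => Real.exp (-g x))
    (θ : ℝ → ℝ) (hθpos : ∀ᶠ a in 𝓝[>] (0 : ℝ), 0 < θ a)
    (hθeq : ∀ᶠ a in 𝓝[>] (0 : ℝ),
      ∫ ω in {ω | X ω - a ≤ 1 / a}, Real.exp (θ a * (X ω - a)) = 1)
    (xb : ℝ → ℝ) (hxb1 : ∀ᶠ a in 𝓝[>] (0 : ℝ), 1 / a ≤ xb a)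
    (hxb2 : Tendsto (fun a => θ a * xb a - g (xb a) - Real.log (a * θ a)) (𝓝[>] 0) (𝓝 0))
    (ε₁ : ℝ) (hε₁ : ε₁ ∈ Set.Ioo (0 : ℝ) 1)
    (hgfast : Tendsto (fun t => g t / t ^ ε₁) atTop atTop) :
    Tendsto (fun a => g (xb a) / (θ a * xb a)) (𝓝[>] 0) (𝓝 1) ∧
    Tendsto (fun a => xb a * θ a ^ (1 / (1 - ε₁))) (𝓝[>] 0) atTop := by
  obtain ⟨hε₁0, hε₁1⟩ := hε₁
  have hid : Tendsto (fun a : ℝ => a) (𝓝[>] 0) (𝓝 0) := tendsto_id.mono_left nhdsWithin_le_nhds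
  have hapos : ∀ᶠ a in 𝓝[>] (0 : ℝ), 0 < a := eventually_mem_nhdsWithin
  have ha1 : ∀ᶠ a in 𝓝[>] (0 : ℝ), a < 1 := hid.eventually_lt_const one_pos
  have hxb : Tendsto xb (𝓝[>] 0) atTop :=
    tendsto_atTop_mono' _ hxb1 (by
      simpa only [← one_div] using tendsto_inv_nhdsGT_zero (𝕜 := ℝ))
  have hgx : Tendsto (fun a => g (xb a) / xb a ^ ε₁) (𝓝[>] 0) atTop := hgfast.comp hxb
  set c := Real.log (σ ^ 2 + 1) with hc
  have hlog := (tendsto_affine_log_div_of_rpow_le hε₁0 hgfast (-2) (-c)).comp hxb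
  have hinv : Tendsto (fun a => 1 / g (xb a)) (𝓝[>] 0) (𝓝 0) := by
    simpa [Function.comp_def] using
      (tendsto_affine_log_div_of_rpow_le hε₁0 hgfast 0 1).comp hxb
  have herr := hxb2.mul hinv
  rw [mul_zero] at herr
  have hlow := (hlog.add herr).const_add 1
  have hup := (herr.const_add 1).div ((hid.pow 2).const_sub 1) (by norm_num)
  norm_num at hlow hup
  have hq : Tendsto (fun a => θ a * xb a / g (xb a)) (𝓝[>] 0) (𝓝 1) := by
    refine tendsto_of_tendsto_of_tendsto_of_le_of_le' hlow hup ?_ ?_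
    · filter_upwards [hapos, ha1, hθpos, hθeq, hxb1] with a ha ha1 hθ heq hx
      have hG := hgpos (xb a)
      have hθa := div_add_one_le_of_truncated_exp_moment_eq_one hXmeas (pow_pos hσ 2) hmean hvar
        ha ha1.le hθ heq
      have hxpos : 0 < xb a := (one_div_pos.2 ha).trans_le hx
      have hla : -Real.log (xb a) ≤ Real.log a := by
        rw [← Real.log_inv]
        exact Real.log_le_log (by positivity) (inv_le_of_inv_le₀ ha (by simpa using hx))
      have hlθ : Real.log a - c ≤ Real.log (θ a) := by
        rw [hc, ← Real.log_div ha.ne' (by positivity)]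
        exact Real.log_le_log (by positivity) hθa
      have hL := Real.log_mul ha.ne' hθ.ne'
      rw [le_div_iff₀ hG]
      generalize Real.log (a * θ a) = l at hL ⊢
      field_simp
      linarith
    · filter_upwards [hapos, ha1, hθpos, hxb1] with a ha ha1 hθ hx
      have hG := hgpos (xb a)
      have hL : Real.log (a * θ a) ≤ a ^ 2 * (θ a * xb a) := by
        have h1 : 1 ≤ a * xb a := by rwa [div_le_iff₀' ha] at hx
        have h2 := Real.log_le_sub_one_of_pos (mul_pos ha hθ)
        nlinarith [mul_le_mul_of_nonneg_left h1 (mul_pos ha hθ).le]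
      have h1 : 0 < 1 - a ^ 2 := by nlinarith
      simp only [Pi.div_apply]
      rw [le_div_iff₀ h1, ← sub_nonneg]
      generalize Real.log (a * θ a) = l at hL ⊢
      field_simp
      linarith
  refine ⟨by simpa using hq.inv₀ one_ne_zero, ?_⟩
  have hprod : Tendsto (fun a => g (xb a) / xb a ^ ε₁ * (θ a * xb a / g (xb a))) (𝓝[>] 0) atTop :=
    hgx.atTop_mul_pos one_pos hq
  have hs : 0 < 1 - ε₁ := by linarith
  refine ((tendsto_rpow_atTop (one_div_pos.2 hs)).comp hprod).congr' ?_
  filter_upwards [hθpos, hxb.eventually_gt_atTop 0] with a hθ hx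
  have hG := hgpos (xb a)
  have hp : 0 < xb a ^ ε₁ := Real.rpow_pos_of_pos hx _
  have heq : g (xb a) / xb a ^ ε₁ * (θ a * xb a / g (xb a)) = xb a ^ (1 - ε₁) * θ a := by
    rw [Real.rpow_sub hx, Real.rpow_one]
    field_simp
  rw [Function.comp_apply, heq, Real.mul_rpow (by positivity) hθ.le, ← Real.rpow_mul hx.le,
    mul_one_div_cancel hs.ne', Real.rpow_one]
end
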